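/- arXiv:2504.19544 — 2 statements merged into one kernel-verified Lean document; each statement's English description precedes it below -/
import Mathlib

section
/- Let I be a decreasing family of finsets of Fin m and let S_f, S_g ∈ I with |S_f| = |S_g| = s ≥ 2. Let i_1 < … < i_s be the increasing enumeration of S_f and j_1 < … < j_s that of S_g, and assume i_s > i_{s−1} > j_s or j_s > j_{s−1} > i_s. Then |LTA(m,2)·x^{S_f} + LTA(m,2)·x^{S_g}| = |LTA(m,2)·x^{S_f}| · |LTA(m,2)·x^{S_g}|, where the sum is the Minkowski sum of sets of Boolean functions. -/
open Pointwise

/-- Boolean functions in `m` variables. -/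
abbrev BF (m : ℕ) := (Fin m → ZMod 2) → ZMod 2

/-- The monomial `x^S`. -/
def mono {m : ℕ} (S : Finset (Fin m)) : BF m := fun v => ∏ i ∈ S, v i

/-- Hamming weight of a Boolean function. -/
def wt {m : ℕ} (F : BF m) : ℕ := (Finset.univ.filter fun v => F v = 1).card

/-- The action of an affine pair `(B, ε)` on the monomial `x^T`. -/
def act {m : ℕ} (B : Fin m → Fin m → ZMod 2) (ε : Fin m → ZMod 2)
    (T : Finset (Fin m)) : BF m :=
  fun v => ∏ i ∈ T, (v i + (∑ j, B i j * v j) + ε i)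

/-- The orbit `LTA(m,2)·x^S` of the monomial `x^S` under the full lower
triangular affine group. -/
def orbitFull {m : ℕ} (S : Finset (Fin m)) : Set (BF m) :=
  { F | ∃ B : Fin m → Fin m → ZMod 2, ∃ ε : Fin m → ZMod 2,
      (∀ i j : Fin m, B i j ≠ 0 → j < i) ∧ F = act B ε S }

/-- The subgroup `LTA(m,2)_S`, as a set of pairs `(B, ε)`. -/
def LTAsub {m : ℕ} (S : Finset (Fin m)) :
    Set ((Fin m → Fin m → ZMod 2) × (Fin m → ZMod 2)) :=
  { p | (∀ i, i ∉ S → p.2 i = 0) ∧ ∀ i j, p.1 i j ≠ 0 → i ∈ S ∧ j < i ∧ j ∉ S }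

/-- The orbit `LTA(m,2)_S·x^T`. -/
def orbitSub {m : ℕ} (S T : Finset (Fin m)) : Set (BF m) :=
  { F | ∃ p ∈ LTAsub S, F = act p.1 p.2 T }

/-- `S ≼_sh T`. -/
def shLE {m : ℕ} (S T : Finset (Fin m)) : Prop :=
  ∃ h : S.card = T.card, ∀ ℓ : Fin S.card,
    S.orderEmbOfFin rfl ℓ ≤ T.orderEmbOfFin h.symm ℓ

/-- `S ≺_sh T`. -/
def shLT {m : ℕ} (S T : Finset (Fin m)) : Prop :=
  ∃ h : S.card = T.card, ∀ ℓ : Fin S.card,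
    S.orderEmbOfFin rfl ℓ < T.orderEmbOfFin h.symm ℓ

/-- `S ≼ T`. -/
def decOrd {m : ℕ} (S T : Finset (Fin m)) : Prop := ∃ T' ⊆ T, shLE S T'

/-- A decreasing family of finsets. -/
def Decreasing {m : ℕ} (I : Finset (Finset (Fin m))) : Prop :=
  ∀ S T : Finset (Fin m), decOrd S T → T ∈ I → S ∈ I

/-- The code `C(I)`: the span of the monomials indexed by `I`. -/
noncomputable def code {m : ℕ} (I : Finset (Finset (Fin m))) :
    Submodule (ZMod 2) (BF m) :=
  Submodule.span (ZMod 2) (mono '' ↑I)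

/-- `J_S(i) = {j < i : j ∉ S}`. -/
def Jset {m : ℕ} (S : Finset (Fin m)) (i : Fin m) : Finset (Fin m) :=
  Finset.univ.filter fun j => j < i ∧ j ∉ S

/-- `J_{fg}(i) = {j < i : j ∉ S_f ∪ S_g}`. -/
def Jfg {m : ℕ} (Sf Sg : Finset (Fin m)) (i : Fin m) : Finset (Fin m) :=
  Jset (Sf ∪ Sg) i

/-- `|λ_S(T)| = ∑_{i ∈ T} |J_S(i)|`. -/
def lamOf {m : ℕ} (S T : Finset (Fin m)) : ℕ := ∑ i ∈ T, (Jset S i).card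

/-- The column set `J_{fg}(i_l)`, where `i_l` is the largest element of
`S_{h*} = (S_f \ S_h) ∩ S_g` (empty if `S_{h*}` is empty). -/
def Jcols {m : ℕ} (Sf Sg Sh : Finset (Fin m)) : Finset (Fin m) :=
  Finset.univ.filter fun j => (∃ i ∈ (Sf \ Sh) ∩ Sg, j < i) ∧ j ∉ Sf ∪ Sg

/-- The restricted subgroup `LTA(m,2)_f^g`: members of `LTA(m,2)_{S_f}` whose
submatrix with rows `S_{h*} = (S_f \ S_h) ∩ S_g` and columns `J_{fg}(i_l)` has
full row rank. -/
def LTAres {m : ℕ} (Sf Sg Sh : Finset (Fin m)) :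
    Set ((Fin m → Fin m → ZMod 2) × (Fin m → ZMod 2)) :=
  { p ∈ LTAsub Sf |
      Matrix.rank
        (Matrix.of fun (i : ((Sf \ Sh) ∩ Sg : Finset (Fin m)))
          (j : (Jcols Sf Sg Sh : Finset (Fin m))) => p.1 i.1 j.1)
        = ((Sf \ Sh) ∩ Sg).card }

/-- The orbit `LTA(m,2)_f^g·x^{S_f \ S_h}`. -/
def orbitRes {m : ℕ} (Sf Sg Sh : Finset (Fin m)) : Set (BF m) :=
  { F | ∃ p ∈ LTAres Sf Sg Sh, F = act p.1 p.2 (Sf \ Sh) }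

/-- `J_f^I(i) = {j < i : j ∉ S_f, (S_f \ {i}) ∪ {j} ∈ I}`. -/
def JfI {m : ℕ} (I : Finset (Finset (Fin m))) (Sf : Finset (Fin m)) (i : Fin m) :
    Finset (Fin m) :=
  Finset.univ.filter fun j => j < i ∧ j ∉ Sf ∧ insert j (Sf.erase i) ∈ I

/-- The orbit `LTA(m,2)_f^{f,I}·x^{S_f \ S_h}`. -/
def orbitFI {m : ℕ} (I : Finset (Finset (Fin m))) (Sf Sh : Finset (Fin m)) :
    Set (BF m) :=
  { F | ∃ B : Fin m → Fin m → ZMod 2, ∃ ε : Fin m → ZMod 2,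
      (∀ i, i ∉ Sf \ Sh → ε i = 0) ∧
      (∀ i j, B i j ≠ 0 → i ∈ Sf \ Sh ∧ j ∈ JfI I Sf i) ∧
      LinearIndependent (ZMod 2) (fun i : ((Sf \ Sh) : Finset (Fin m)) => B i.1) ∧
      F = act B ε (Sf \ Sh) }

/-- A function in the orbit of `x^S` depends only on the coordinates up to the largest element
of `S`. -/
lemma act_congr {m : ℕ} {B : Fin m → Fin m → ZMod 2} (hB : ∀ i j : Fin m, B i j ≠ 0 → j < i)
    (ε : Fin m → ZMod 2) {S : Finset (Fin m)} {p : Fin m} (hS : ∀ i ∈ S, i < p)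
    {v w : Fin m → ZMod 2} (hvw : ∀ k < p, v k = w k) : act B ε S v = act B ε S w := by
  refine Finset.prod_congr rfl fun i hi => ?_
  rw [hvw i (hS i hi)]
  congr 2
  refine Finset.sum_congr rfl fun j _ => ?_
  by_cases h : B i j = 0
  · simp [h]
  · rw [hvw j ((hB i j h).trans (hS i hi))]

/-- Changing the coordinate `i` alone makes the `i`-th factor vanish. -/
lemma act_update_eq_zero {m : ℕ} {B : Fin m → Fin m → ZMod 2}
    (hB : ∀ i j : Fin m, B i j ≠ 0 → j < i) (ε : Fin m → ZMod 2) {S : Finset (Fin m)}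
    {i : Fin m} (hi : i ∈ S) {v w : Fin m → ZMod 2}
    (hwi : w i = (∑ j, B i j * v j) + ε i) (hw : ∀ k < i, w k = v k) :
    act B ε S w = 0 := by
  refine Finset.prod_eq_zero hi ?_
  have hsum : ∑ j, B i j * w j = ∑ j, B i j * v j := by
    refine Finset.sum_congr rfl fun j _ => ?_
    by_cases h : B i j = 0
    · simp [h]
    · rw [hw j (hB i j h)]
  rw [hsum, hwi, add_assoc]
  exact CharTwo.add_self_eq_zero _

/-- If two elements of `S` exceed every element of `T`, then addition is injective on the product
of the orbits of `x^S` and `x^T`. -/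
lemma ncard_orbitFull_add {m : ℕ} {S T : Finset (Fin m)} {p q : Fin m} (hp : p ∈ S) (hq : q ∈ S)
    (hpq : p < q) (hT : ∀ i ∈ T, i < p) :
    (orbitFull S + orbitFull T).ncard = (orbitFull S).ncard * (orbitFull T).ncard := by
  rw [← Set.add_image_prod, Set.InjOn.ncard_image, Set.ncard_prod]
  rintro ⟨_, _⟩ ⟨⟨B, ε, hB, rfl⟩, ⟨C, δ, hC, rfl⟩⟩ ⟨_, _⟩ ⟨⟨B', ε', hB', rfl⟩, ⟨C', δ', hC', rfl⟩⟩ h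
  have h : act B ε S + act C δ T = act B' ε' S + act C' δ' T := h
  have hS : act B ε S = act B' ε' S := by
    funext v
    let u := Function.update v p ((∑ j, B p j * v j) + ε p)
    let w := Function.update u q ((∑ j, B' q j * u j) + ε' q)
    have hwv : ∀ k < p, w k = v k := fun k hk => by
      simp [w, u, (hk.trans hpq).ne, hk.ne]
    have hw : act B ε S w = 0 :=
      act_update_eq_zero hB ε hp (v := v) (by simp [w, u, hpq.ne]) hwv
    have hw' : act B' ε' S w = 0 :=
      act_update_eq_zero hB' ε' hq (v := u) (by simp [w]) fun k hk => by simp [w, hk.ne]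
    have hv := congrFun h v
    have hc := congrFun h w
    simp only [Pi.add_apply, hw, hw', zero_add, act_congr hC δ hT hwv,
      act_congr hC' δ' hT hwv] at hv hc
    rw [hc] at hv
    exact add_right_cancel hv
  rw [hS] at h
  rw [hS, add_left_cancel h]

/-- for `S_f, S_g ∈ I` with `|S_f| = |S_g| = s ≥ 2` whose increasing
enumerations satisfy `i_s > i_{s−1} > j_s` or `j_s > j_{s−1} > i_s`, the
Minkowski sum of the full orbits has cardinality the product of the
cardinalities. -/
theorem stmt4 (m s : ℕ) (I : Finset (Finset (Fin m))) (hI : Decreasing I)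
    (Sf Sg : Finset (Fin m)) (hf : Sf ∈ I) (hg : Sg ∈ I)
    (hfc : Sf.card = s) (hgc : Sg.card = s) (hs2 : 2 ≤ s)
    (hcond :
      (Sf.orderEmbOfFin hfc ⟨s - 1, by omega⟩ >
          Sf.orderEmbOfFin hfc ⟨s - 2, by omega⟩ ∧
        Sf.orderEmbOfFin hfc ⟨s - 2, by omega⟩ >
          Sg.orderEmbOfFin hgc ⟨s - 1, by omega⟩) ∨
      (Sg.orderEmbOfFin hgc ⟨s - 1, by omega⟩ >
          Sg.orderEmbOfFin hgc ⟨s - 2, by omega⟩ ∧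
        Sg.orderEmbOfFin hgc ⟨s - 2, by omega⟩ >
          Sf.orderEmbOfFin hfc ⟨s - 1, by omega⟩)) :
    (orbitFull Sf + orbitFull Sg).ncard =
      (orbitFull Sf).ncard * (orbitFull Sg).ncard := by
  have key : ∀ {S T : Finset (Fin m)} (hS : S.card = s) (hT : T.card = s),
      S.orderEmbOfFin hS ⟨s - 1, by omega⟩ > S.orderEmbOfFin hS ⟨s - 2, by omega⟩ ∧
        S.orderEmbOfFin hS ⟨s - 2, by omega⟩ > T.orderEmbOfFin hT ⟨s - 1, by omega⟩ →
      (orbitFull S + orbitFull T).ncard = (orbitFull S).ncard * (orbitFull T).ncard := by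
    rintro S T hS hT ⟨h₁, h₂⟩
    refine ncard_orbitFull_add (S.orderEmbOfFin_mem hS _) (S.orderEmbOfFin_mem hS _) h₁
      fun i hi => ?_
    rw [Finset.orderEmbOfFin_last hT (by omega)] at h₂
    exact (T.le_max' i hi).trans_lt h₂
  rcases hcond with h | h
  · exact key hfc hgc h
  · rw [add_comm, mul_comm]
    exact key hgc hfc h
end

section
/- Let I be a decreasing family of finsets of Fin m with r = max_{T ∈ I} |T|, and let μ satisfy m − r ≥ μ and r ≥ μ ≥ 3; set w_μ = 2^{m+1−r} − 2^{m+1−r−μ}. Let S_f, S_g ∈ I_r with S_h := S_f ∩ S_g satisfying |S_h| = r − μ, and set O = LTA(m,2)_{S_h}·x^{S_h} · (LTA(m,2)_{S_f}·x^{S_f\S_h} + LTA(m,2)_{S_g}·x^{S_g\S_h}). Then every element of O has Hamming weight w_μ, and |O| = |LTA(m,2)_{S_h}·x^{S_h}| · |LTA(m,2)_{S_f}·x^{S_f\S_h}| · |LTA(m,2)_{S_g}·x^{S_g\S_h}|. -/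
open Pointwise

/-- The support of a Boolean function. -/
def bfSupp {m : ℕ} (F : BF m) : Finset (Fin m → ZMod 2) := Finset.univ.filter fun v => F v = 1

lemma mem_bfSupp {m : ℕ} {F : BF m} {v : Fin m → ZMod 2} : v ∈ bfSupp F ↔ F v = 1 := by
  simp [bfSupp]

lemma wt_eq_card_bfSupp {m : ℕ} (F : BF m) : wt F = (bfSupp F).card := rfl

lemma bfSupp_injective {m : ℕ} : Function.Injective (bfSupp (m := m)) := by
  intro F G h
  funext v
  have hv : F v = 1 ↔ G v = 1 := by rw [← mem_bfSupp, ← mem_bfSupp, h]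
  generalize F v = a at hv
  generalize G v = b at hv
  revert a b
  decide

lemma bfSupp_mul {m : ℕ} (F G : BF m) : bfSupp (F * G) = bfSupp F ∩ bfSupp G := by
  ext v
  simp only [Finset.mem_inter, mem_bfSupp, Pi.mul_apply]
  generalize F v = a
  generalize G v = b
  revert a b
  decide

lemma bfSupp_add {m : ℕ} (F G : BF m) : bfSupp (F + G) = symmDiff (bfSupp F) (bfSupp G) := by
  ext v
  simp only [Finset.mem_symmDiff, mem_bfSupp, Pi.add_apply]
  generalize F v = a
  generalize G v = b
  revert a b
  decide

lemma mono_eq_one_iff {m : ℕ} (T : Finset (Fin m)) (v : Fin m → ZMod 2) :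
    mono T v = 1 ↔ ∀ i ∈ T, v i = 1 := by
  refine ⟨fun h i hi => ?_, fun h => Finset.prod_eq_one h⟩
  have h0 : v i ≠ 0 := fun h0 => by
    rw [mono, Finset.prod_eq_zero hi h0] at h
    exact zero_ne_one h
  revert h0
  generalize v i = a
  revert a
  decide

lemma card_bfSupp_mono {m : ℕ} (T : Finset (Fin m)) :
    (bfSupp (mono T)).card = 2 ^ (m - T.card) := by
  have h : bfSupp (mono T) =
      Fintype.piFinset fun i => if i ∈ T then ({1} : Finset (ZMod 2)) else Finset.univ := by
    ext v
    simp only [mem_bfSupp, mono_eq_one_iff, Fintype.mem_piFinset]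
    refine forall_congr' fun i => ?_
    by_cases hi : i ∈ T <;> simp [hi]
  rw [h, Fintype.card_piFinset]
  simp only [apply_ite Finset.card, Finset.card_singleton, Finset.card_univ, ZMod.card]
  rw [Finset.prod_ite, Finset.prod_const_one, one_mul, Finset.prod_const, ← Finset.compl_filter,
    Finset.card_compl]
  simp

lemma card_bfSupp_comp {m : ℕ} (F : BF m) (Φ : Equiv.Perm (Fin m → ZMod 2)) :
    (bfSupp (F ∘ Φ)).card = (bfSupp F).card :=
  Finset.card_equiv Φ fun v => by simp [mem_bfSupp]

lemma mono_union {m : ℕ} {S T : Finset (Fin m)} (h : Disjoint S T) :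
    mono (S ∪ T) = mono S * mono T :=
  funext fun _ => Finset.prod_union h

/-- The affine map attached to a pair `(B, ε)`. -/
def affMap {m : ℕ} (B : Fin m → Fin m → ZMod 2) (ε : Fin m → ZMod 2)
    (v : Fin m → ZMod 2) : Fin m → ZMod 2 :=
  fun i => v i + (∑ j, B i j * v j) + ε i

lemma act_eq_mono_comp {m : ℕ} (B : Fin m → Fin m → ZMod 2) (ε : Fin m → ZMod 2)
    (T : Finset (Fin m)) : act B ε T = mono T ∘ affMap B ε := rfl

lemma affMap_add_add {m : ℕ} (B : Fin m → Fin m → ZMod 2) (ε x y z : Fin m → ZMod 2) :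
    affMap B ε (x + y + z) = affMap B ε x + affMap B ε y + affMap B ε z := by
  funext i
  simp only [affMap, Pi.add_apply, mul_add, Finset.sum_add_distrib]
  linear_combination -CharTwo.add_self_eq_zero (ε i)

lemma affMap_injective {m : ℕ} {B : Fin m → Fin m → ZMod 2} (hB : ∀ i j, B i j ≠ 0 → j < i)
    (ε : Fin m → ZMod 2) : Function.Injective (affMap B ε) := by
  intro x y h
  funext i
  induction i using WellFoundedLT.induction with
  | ind i ih =>
    have hs : ∑ j, B i j * x j = ∑ j, B i j * y j := by
      refine Finset.sum_congr rfl fun j _ => ?_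
      by_cases hj : B i j = 0
      · simp [hj]
      · rw [ih j (hB i j hj)]
    have hi := congrFun h i
    simp only [affMap, hs] at hi
    exact add_right_cancel (add_right_cancel hi)

lemma vec_add_self {m : ℕ} (v : Fin m → ZMod 2) : v + v = 0 :=
  funext fun i => CharTwo.add_self_eq_zero (v i)

/-- A set of vectors is closed under sums of three elements. -/
def TernaryClosed {m : ℕ} (A : Finset (Fin m → ZMod 2)) : Prop :=
  ∀ x ∈ A, ∀ y ∈ A, ∀ z ∈ A, x + y + z ∈ A

lemma TernaryClosed.inter {m : ℕ} {A A' : Finset (Fin m → ZMod 2)} (hA : TernaryClosed A)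
    (hA' : TernaryClosed A') : TernaryClosed (A ∩ A') := by
  intro x hx y hy z hz
  rw [Finset.mem_inter] at *
  exact ⟨hA x hx.1 y hy.1 z hz.1, hA' x hx.2 y hy.2 z hz.2⟩

lemma ternaryClosed_bfSupp_act {m : ℕ} (B : Fin m → Fin m → ZMod 2) (ε : Fin m → ZMod 2)
    (T : Finset (Fin m)) : TernaryClosed (bfSupp (act B ε T)) := by
  intro x hx y hy z hz
  simp only [mem_bfSupp, act_eq_mono_comp, Function.comp_apply, mono_eq_one_iff,
    affMap_add_add, Pi.add_apply] at *
  intro i hi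
  rw [hx i hi, hy i hi, hz i hi]
  decide

lemma TernaryClosed.two_mul_card_inter_le {m : ℕ} {A A' : Finset (Fin m → ZMod 2)}
    (hA : TernaryClosed A) (hA' : TernaryClosed A') (h : ¬ A ⊆ A') :
    2 * (A ∩ A').card ≤ A.card := by
  obtain ⟨a, haA, haA'⟩ := Finset.not_subset.1 h
  have hle : (A ∩ A').card ≤ (A \ A').card := by
    rcases (A ∩ A').eq_empty_or_nonempty with he | ⟨b, hb⟩
    · simp [he]
    rw [Finset.mem_inter] at hb
    refine Finset.card_le_card_of_injOn (fun x => x + b + a) (fun x hx => ?_)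
      (fun x _ y _ hxy => add_right_cancel (add_right_cancel hxy))
    rw [Finset.mem_coe, Finset.mem_inter] at hx
    rw [Finset.mem_coe, Finset.mem_sdiff]
    refine ⟨hA x hx.1 b hb.1 a haA, fun hc => ?_⟩
    have hsum := hA' x hx.2 b hb.2 _ hc
    have hxb : x + b + (x + b + a) = a := by
      rw [← add_assoc, vec_add_self, zero_add]
    exact haA' (hxb ▸ hsum)
  have := Finset.card_sdiff_add_card_inter A A'
  omega

lemma TernaryClosed.eq_of_symmDiff_eq {m : ℕ} {A B A' B' : Finset (Fin m → ZMod 2)}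
    (hA : TernaryClosed A) (hA' : TernaryClosed A') (hpos : 0 < A.card)
    (hcard : A.card = A'.card) (h : symmDiff A B = symmDiff A' B')
    (hAB : 8 * (A ∩ B).card ≤ A.card) (hAB' : 8 * (A ∩ B').card ≤ A.card) : A = A' := by
  by_contra hne
  have hns : ¬ A ⊆ A' := fun hs => hne (Finset.eq_of_subset_of_card_le hs hcard.ge)
  have h2 := hA.two_mul_card_inter_le hA' hns
  have hcov : A ⊆ A ∩ A' ∪ A ∩ B' ∪ A ∩ B := by
    intro x hx
    have hx' := Finset.ext_iff.1 h x
    simp only [Finset.mem_symmDiff, Finset.mem_union, Finset.mem_inter] at *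
    tauto
  have h3 := Finset.card_le_card hcov
  have h4 := Finset.card_union_le (A ∩ A' ∪ A ∩ B') (A ∩ B)
  have h5 := Finset.card_union_le (A ∩ A') (A ∩ B')
  omega

lemma card_symmDiff_add_two_mul_card_inter {α : Type*} [DecidableEq α] (A B : Finset α) :
    (symmDiff A B).card + 2 * (A ∩ B).card = A.card + B.card := by
  have h : (symmDiff A B).card = (A \ B).card + (B \ A).card :=
    Finset.card_union_of_disjoint disjoint_sdiff_sdiff
  have h1 := Finset.card_sdiff_add_card_inter A B
  have h2 := Finset.card_sdiff_add_card_inter B A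
  rw [Finset.inter_comm B A] at h2
  omega

/-- Three actions on disjoint monomials are simultaneously given by one affine bijection. -/
lemma exists_perm_act {m : ℕ} {H P Q : Finset (Fin m)} (hHP : Disjoint H P) (hHQ : Disjoint H Q)
    (hPQ : Disjoint P Q) {s p q : (Fin m → Fin m → ZMod 2) × (Fin m → ZMod 2)}
    (hs : ∀ i j, s.1 i j ≠ 0 → j < i) (hp : ∀ i j, p.1 i j ≠ 0 → j < i)
    (hq : ∀ i j, q.1 i j ≠ 0 → j < i) :
    ∃ Φ : Equiv.Perm (Fin m → ZMod 2), (∀ x y z, Φ (x + y + z) = Φ x + Φ y + Φ z) ∧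
      act s.1 s.2 H = mono H ∘ Φ ∧ act p.1 p.2 P = mono P ∘ Φ ∧ act q.1 q.2 Q = mono Q ∘ Φ := by
  let c : Fin m → (Fin m → Fin m → ZMod 2) × (Fin m → ZMod 2) :=
    fun i => if i ∈ H then s else if i ∈ P then p else q
  have hc : ∀ i j, (c i).1 i j ≠ 0 → j < i := by
    intro i j
    dsimp only [c]
    split_ifs
    exacts [hs i j, hp i j, hq i j]
  have key : ∀ (T : Finset (Fin m)) (t : (Fin m → Fin m → ZMod 2) × (Fin m → ZMod 2)),
      (∀ i ∈ T, c i = t) →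
      act t.1 t.2 T = mono T ∘ affMap (fun i => (c i).1 i) (fun i => (c i).2 i) := by
    intro T t ht
    funext v
    refine Finset.prod_congr rfl fun i hi => ?_
    simp only [affMap, ht i hi]
  refine ⟨Equiv.ofBijective _ (Finite.injective_iff_bijective.1
    (affMap_injective hc fun i => (c i).2 i)),
    affMap_add_add _ _, key H s fun i hi => if_pos hi,
    key P p fun i hi => ?_, key Q q fun i hi => ?_⟩
  · simp [c, hi, Finset.disjoint_right.1 hHP hi]
  · simp [c, Finset.disjoint_right.1 hHQ hi, Finset.disjoint_right.1 hPQ hi]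

section CardInter

variable {m : ℕ} {H P Q : Finset (Fin m)} {h f g : BF m}

lemma card_bfSupp_inter (hHP : Disjoint H P) {Φ : Equiv.Perm (Fin m → ZMod 2)}
    (hh : h = mono H ∘ Φ) (hf : f = mono P ∘ Φ) :
    (bfSupp h ∩ bfSupp f).card = 2 ^ (m - (H.card + P.card)) := by
  rw [← bfSupp_mul, hh, hf, ← Finset.card_union_of_disjoint hHP, ← card_bfSupp_mono,
    ← card_bfSupp_comp (mono (H ∪ P)) Φ, mono_union hHP]
  rfl

lemma card_bfSupp_inter_inter (hHP : Disjoint H P) (hHQ : Disjoint H Q) (hPQ : Disjoint P Q)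
    {Φ : Equiv.Perm (Fin m → ZMod 2)}
    (hh : h = mono H ∘ Φ) (hf : f = mono P ∘ Φ) (hg : g = mono Q ∘ Φ) :
    (bfSupp h ∩ bfSupp f ∩ bfSupp g).card = 2 ^ (m - (H.card + P.card + Q.card)) := by
  rw [← bfSupp_mul, ← Finset.card_union_of_disjoint hHP]
  refine card_bfSupp_inter (Finset.disjoint_union_left.2 ⟨hHQ, hPQ⟩) (Φ := Φ) ?_ hg
  rw [hh, hf, mono_union hHP]
  rfl

end CardInter

/-- Changing only the coordinates in `H`, one reaches the support of an element of the orbit of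
`x^H`. -/
lemma exists_act_eq_one {m : ℕ} {H : Finset (Fin m)}
    {s : (Fin m → Fin m → ZMod 2) × (Fin m → ZMod 2)} (hs : s ∈ LTAsub H) (v : Fin m → ZMod 2) :
    ∃ w, act s.1 s.2 H w = 1 ∧ ∀ j ∉ H, w j = v j := by
  obtain ⟨w, hw⟩ := (Finite.injective_iff_bijective.1
    (affMap_injective (fun i j hij => (hs.2 i j hij).2.1) s.2)).2 fun i => if i ∈ H then 1 else v i
  refine ⟨w, ?_, fun j hj => ?_⟩
  · rw [act_eq_mono_comp, Function.comp_apply, mono_eq_one_iff, hw]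
    exact fun i hi => if_pos hi
  · have hwj := congrFun hw j
    have h0 : ∀ k, s.1 j k = 0 := fun k => by
      by_contra hk
      exact hj (hs.2 j k hk).1
    simpa [affMap, h0, hs.1 j hj, hj] using hwj

lemma act_congr_off {m : ℕ} {S H T : Finset (Fin m)} (hHS : H ⊆ S) (hTH : Disjoint T H)
    {p : (Fin m → Fin m → ZMod 2) × (Fin m → ZMod 2)} (hp : p ∈ LTAsub S)
    {v w : Fin m → ZMod 2} (hvw : ∀ j ∉ H, w j = v j) : act p.1 p.2 T w = act p.1 p.2 T v := by
  refine Finset.prod_congr rfl fun i hi => ?_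
  rw [hvw i (Finset.disjoint_left.1 hTH hi)]
  congr 2
  refine Finset.sum_congr rfl fun j _ => ?_
  by_cases hj : p.1 i j = 0
  · simp [hj]
  · rw [hvw j fun hjH => (hp.2 i j hj).2.2 (hHS hjH)]

/-- The factor outside `H` is determined by its product with an element of the orbit of `x^H`. -/
lemma bfSupp_act_subset_of_inter_subset {m : ℕ} {S H T : Finset (Fin m)} (hHS : H ⊆ S)
    (hTH : Disjoint T H) {s p p' : (Fin m → Fin m → ZMod 2) × (Fin m → ZMod 2)}
    {h' : BF m} (hs : s ∈ LTAsub H) (hp : p ∈ LTAsub S) (hp' : p' ∈ LTAsub S)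
    (hsub : bfSupp (act s.1 s.2 H) ∩ bfSupp (act p.1 p.2 T) ⊆
      bfSupp h' ∩ bfSupp (act p'.1 p'.2 T)) :
    bfSupp (act p.1 p.2 T) ⊆ bfSupp (act p'.1 p'.2 T) := by
  intro v hv
  obtain ⟨w, hw, hwv⟩ := exists_act_eq_one hs v
  rw [mem_bfSupp] at hv ⊢
  have hmem := hsub (Finset.mem_inter.2 ⟨mem_bfSupp.2 hw,
    mem_bfSupp.2 ((act_congr_off hHS hTH hp hwv).trans hv)⟩)
  rw [← act_congr_off hHS hTH hp' hwv]
  exact mem_bfSupp.1 (Finset.mem_inter.1 hmem).2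

/-- The support of `x^H` is the ternary closure of those of `x^H x^P` and `x^H x^Q`. -/
lemma bfSupp_subset_of_ternaryClosed {m : ℕ} {H P Q : Finset (Fin m)} (hHP : Disjoint H P)
    (hHQ : Disjoint H Q) (hPQ : Disjoint P Q)
    {s p q : (Fin m → Fin m → ZMod 2) × (Fin m → ZMod 2)}
    (hs : ∀ i j, s.1 i j ≠ 0 → j < i) (hp : ∀ i j, p.1 i j ≠ 0 → j < i)
    (hq : ∀ i j, q.1 i j ≠ 0 → j < i) {A : Finset (Fin m → ZMod 2)} (hA : TernaryClosed A)
    (hP : bfSupp (act s.1 s.2 H) ∩ bfSupp (act p.1 p.2 P) ⊆ A)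
    (hQ : bfSupp (act s.1 s.2 H) ∩ bfSupp (act q.1 q.2 Q) ⊆ A) :
    bfSupp (act s.1 s.2 H) ⊆ A := by
  intro v hv
  obtain ⟨Φ, hΦ, hΦs, hΦp, hΦq⟩ := exists_perm_act hHP hHQ hPQ hs hp hq
  simp only [hΦs, hΦp, hΦq] at *
  simp only [Finset.subset_iff, Finset.mem_inter, mem_bfSupp, Function.comp_apply,
    mono_eq_one_iff] at hP hQ hv
  obtain ⟨a, ha⟩ := Φ.surjective fun i => if i ∈ H ∪ P then 1 else Φ v i
  obtain ⟨c, hc⟩ := Φ.surjective 1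
  have haA : a ∈ A := hP ⟨fun i hi => by simp [ha, hi], fun i hi => by simp [ha, hi]⟩
  have hcA : c ∈ A := hP ⟨fun i _ => by simp [hc], fun i _ => by simp [hc]⟩
  have hbA : v + a + c ∈ A := by
    refine hQ ⟨fun i hi => ?_, fun i hi => ?_⟩
    · rw [hΦ, Pi.add_apply, Pi.add_apply, hv i hi, congrFun ha i,
        if_pos (Finset.mem_union_left _ hi), hc, Pi.one_apply]
      decide
    · rw [hΦ, Pi.add_apply, Pi.add_apply, congrFun ha i, hc, if_neg, CharTwo.add_self_eq_zero, zero_add,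
        Pi.one_apply]
      rw [Finset.mem_union, not_or]
      exact ⟨Finset.disjoint_right.1 hHQ hi, Finset.disjoint_right.1 hPQ hi⟩
  have hsum : a + (v + a + c) + c = v := by
    have h1 := vec_add_self a
    have h2 := vec_add_self c
    linear_combination h1 + h2
  rw [← hsum]
  exact hA a haA _ hbA c hcA

lemma LTAsub.lt {m : ℕ} {S : Finset (Fin m)}
    {p : (Fin m → Fin m → ZMod 2) × (Fin m → ZMod 2)} (hp : p ∈ LTAsub S) :
    ∀ i j, p.1 i j ≠ 0 → j < i := fun i j hij => (hp.2 i j hij).2.1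

section Orbits

variable {m : ℕ} {H P Q Sf Sg : Finset (Fin m)}

lemma wt_mul_add {h f g : BF m} (hHP : Disjoint H P) (hHQ : Disjoint H Q) (hPQ : Disjoint P Q)
    (hc : P.card = Q.card) (hh : h ∈ orbitSub H H) (hf : f ∈ orbitSub Sf P)
    (hg : g ∈ orbitSub Sg Q) :
    wt (h * (f + g)) + 2 * 2 ^ (m - (H.card + P.card + Q.card)) =
      2 * 2 ^ (m - (H.card + P.card)) := by
  obtain ⟨s, hs, rfl⟩ := hh
  obtain ⟨p, hp, rfl⟩ := hf
  obtain ⟨q, hq, rfl⟩ := hg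
  obtain ⟨Φ, -, hΦs, hΦp, hΦq⟩ :=
    exists_perm_act hHP hHQ hPQ (LTAsub.lt hs) (LTAsub.lt hp) (LTAsub.lt hq)
  rw [← card_bfSupp_inter_inter hHP hHQ hPQ hΦs hΦp hΦq, wt_eq_card_bfSupp, mul_add, bfSupp_add,
    Finset.inter_assoc, Finset.inter_inter_distrib_left, ← bfSupp_mul, ← bfSupp_mul,
    card_symmDiff_add_two_mul_card_inter, bfSupp_mul, bfSupp_mul, card_bfSupp_inter hHP hΦs hΦp,
    card_bfSupp_inter hHQ hΦs hΦq, hc, two_mul]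

/-- The first of the two flats is determined by the symmetric difference. -/
lemma bfSupp_inter_eq_of_mul_add_eq {h f g h' f' g' : BF m} (hHP : Disjoint H P)
    (hHQ : Disjoint H Q) (hPQ : Disjoint P Q) (hQ : 3 ≤ Q.card)
    (hm : H.card + P.card + Q.card ≤ m) (hh : h ∈ orbitSub H H) (hf : f ∈ orbitSub Sf P)
    (hg : g ∈ orbitSub Sg Q) (hh' : h' ∈ orbitSub H H) (hf' : f' ∈ orbitSub Sf P)
    (hg' : g' ∈ orbitSub Sg Q) (heq : h * (f + g) = h' * (f' + g')) :
    bfSupp h ∩ bfSupp f = bfSupp h' ∩ bfSupp f' := by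
  obtain ⟨s, hs, rfl⟩ := hh
  obtain ⟨p, hp, rfl⟩ := hf
  obtain ⟨q, hq, rfl⟩ := hg
  obtain ⟨s', hs', rfl⟩ := hh'
  obtain ⟨p', hp', rfl⟩ := hf'
  obtain ⟨q', hq', rfl⟩ := hg'
  obtain ⟨Φ, -, hΦs, hΦp, hΦq⟩ :=
    exists_perm_act hHP hHQ hPQ (LTAsub.lt hs) (LTAsub.lt hp) (LTAsub.lt hq)
  obtain ⟨Φ₁, -, hΦs₁, hΦp₁, hΦq₁⟩ :=
    exists_perm_act hHP hHQ hPQ (LTAsub.lt hs) (LTAsub.lt hp) (LTAsub.lt hq')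
  obtain ⟨Φ', -, hΦs', hΦp', hΦq'⟩ :=
    exists_perm_act hHP hHQ hPQ (LTAsub.lt hs') (LTAsub.lt hp') (LTAsub.lt hq')
  have hpow : 8 * 2 ^ (m - (H.card + P.card + Q.card)) ≤ 2 ^ (m - (H.card + P.card)) := by
    rw [show 8 = 2 ^ 3 from rfl, ← pow_add]
    exact Nat.pow_le_pow_right two_pos (by omega)
  have hcA := card_bfSupp_inter hHP hΦs hΦp
  refine ((ternaryClosed_bfSupp_act _ _ _).inter (ternaryClosed_bfSupp_act _ _ _)).eq_of_symmDiff_eq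
    (B := bfSupp (act s.1 s.2 H) ∩ bfSupp (act q.1 q.2 Q))
    (B' := bfSupp (act s'.1 s'.2 H) ∩ bfSupp (act q'.1 q'.2 Q))
    ((ternaryClosed_bfSupp_act _ _ _).inter (ternaryClosed_bfSupp_act _ _ _)) ?_
    (hcA.trans (card_bfSupp_inter hHP hΦs' hΦp').symm) ?_ ?_ ?_
  · rw [hcA]
    positivity
  · simpa only [mul_add, bfSupp_add, bfSupp_mul] using congrArg bfSupp heq
  · rw [← Finset.inter_inter_distrib_left, ← Finset.inter_assoc,
      card_bfSupp_inter_inter hHP hHQ hPQ hΦs hΦp hΦq, hcA]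
    exact hpow
  · refine (Nat.mul_le_mul_left 8 (Finset.card_le_card
      (Finset.inter_subset_inter_left Finset.inter_subset_right))).trans ?_
    rw [card_bfSupp_inter_inter hHP hHQ hPQ hΦs₁ hΦp₁ hΦq₁, hcA]
    exact hpow

lemma eq_of_bfSupp_inter_eq {h f h' f' : BF m} (hHS : H ⊆ Sf) (hHP : Disjoint H P)
    (hh : h ∈ orbitSub H H) (hf : f ∈ orbitSub Sf P) (hh' : h' ∈ orbitSub H H)
    (hf' : f' ∈ orbitSub Sf P) (heq : bfSupp h ∩ bfSupp f = bfSupp h' ∩ bfSupp f') : f = f' := by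
  obtain ⟨s, hs, rfl⟩ := hh
  obtain ⟨p, hp, rfl⟩ := hf
  obtain ⟨s', hs', rfl⟩ := hh'
  obtain ⟨p', hp', rfl⟩ := hf'
  exact bfSupp_injective (Finset.Subset.antisymm
    (bfSupp_act_subset_of_inter_subset hHS hHP.symm hs hp hp' heq.subset)
    (bfSupp_act_subset_of_inter_subset hHS hHP.symm hs' hp' hp heq.superset))

lemma bfSupp_subset_of_inter_eq {h f g h' f' g' : BF m} (hHP : Disjoint H P)
    (hHQ : Disjoint H Q) (hPQ : Disjoint P Q)
    (hh : h ∈ orbitSub H H) (hf : f ∈ orbitSub Sf P) (hg : g ∈ orbitSub Sg Q)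
    (hh' : h' ∈ orbitSub H H) (hA : bfSupp h ∩ bfSupp f = bfSupp h' ∩ bfSupp f')
    (hB : bfSupp h ∩ bfSupp g = bfSupp h' ∩ bfSupp g') : bfSupp h ⊆ bfSupp h' := by
  obtain ⟨s, hs, rfl⟩ := hh
  obtain ⟨p, hp, rfl⟩ := hf
  obtain ⟨q, hq, rfl⟩ := hg
  obtain ⟨s', hs', rfl⟩ := hh'
  exact bfSupp_subset_of_ternaryClosed hHP hHQ hPQ (LTAsub.lt hs) (LTAsub.lt hp) (LTAsub.lt hq)
    (ternaryClosed_bfSupp_act _ _ _) (hA.subset.trans Finset.inter_subset_left)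
    (hB.subset.trans Finset.inter_subset_left)

lemma ncard_orbit_mul_add (hHf : H ⊆ Sf) (hHg : H ⊆ Sg) (hHP : Disjoint H P)
    (hHQ : Disjoint H Q) (hPQ : Disjoint P Q) (hP : 3 ≤ P.card) (hQ : 3 ≤ Q.card)
    (hm : H.card + P.card + Q.card ≤ m) :
    (orbitSub H H * (orbitSub Sf P + orbitSub Sg Q)).ncard =
      (orbitSub H H).ncard * (orbitSub Sf P).ncard * (orbitSub Sg Q).ncard := by
  have himg : orbitSub H H * (orbitSub Sf P + orbitSub Sg Q) =
      (fun x : BF m × BF m × BF m => x.1 * (x.2.1 + x.2.2)) ''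
        (orbitSub H H ×ˢ orbitSub Sf P ×ˢ orbitSub Sg Q) := by
    ext F
    simp only [Set.mem_mul, Set.mem_add, Set.mem_image, Set.mem_prod, Prod.exists]
    constructor
    · rintro ⟨h, hh, _, ⟨f, hf, g, hg, rfl⟩, rfl⟩
      exact ⟨h, f, g, ⟨hh, hf, hg⟩, rfl⟩
    · rintro ⟨h, f, g, ⟨hh, hf, hg⟩, rfl⟩
      exact ⟨h, hh, _, ⟨f, hf, g, hg, rfl⟩, rfl⟩
  rw [himg, Set.InjOn.ncard_image, Set.ncard_prod, Set.ncard_prod, mul_assoc]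
  rintro ⟨h, f, g⟩ ⟨hh, hf, hg⟩ ⟨h', f', g'⟩ ⟨hh', hf', hg'⟩ heq
  have hA := bfSupp_inter_eq_of_mul_add_eq hHP hHQ hPQ hQ hm hh hf hg hh' hf' hg' heq
  have hB := bfSupp_inter_eq_of_mul_add_eq hHQ hHP hPQ.symm hP (by omega) hh hg hf hh' hg' hf'
    (by simpa only [add_comm] using heq)
  have hfe := eq_of_bfSupp_inter_eq hHf hHP hh hf hh' hf' hA
  have hge := eq_of_bfSupp_inter_eq hHg hHQ hh hg hh' hg' hB
  have hhe : h = h' := bfSupp_injective (Finset.Subset.antisymm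
    (bfSupp_subset_of_inter_eq hHP hHQ hPQ hh hf hg hh' hA hB)
    (bfSupp_subset_of_inter_eq hHP hHQ hPQ hh' hf' hg' hh hA.symm hB.symm))
  exact Prod.ext hhe (Prod.ext hfe hge)

end Orbits

/-- sub-case A.1: if `S_h = S_f ∩ S_g` has `|S_h| = r − μ`, then
every element of the orbit
`LTA(m,2)_{S_h}·x^{S_h}·(LTA(m,2)_{S_f}·x^{S_f\S_h} + LTA(m,2)_{S_g}·x^{S_g\S_h})`
has Hamming weight `w_μ`, and its cardinality is the product of the three orbit
cardinalities. -/
theorem stmt9 (m r μ : ℕ) (I : Finset (Finset (Fin m))) (hI : Decreasing I)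
    (hmax : ∀ T ∈ I, T.card ≤ r) (hex : ∃ T ∈ I, T.card = r)
    (hμ3 : 3 ≤ μ) (hμr : μ ≤ r) (hrm : μ ≤ m - r)
    (Sf Sg : Finset (Fin m)) (hf : Sf ∈ I) (hfc : Sf.card = r)
    (hg : Sg ∈ I) (hgc : Sg.card = r)
    (hh : (Sf ∩ Sg).card = r - μ) :
    (∀ F ∈ orbitSub (Sf ∩ Sg) (Sf ∩ Sg) *
        (orbitSub Sf (Sf \ (Sf ∩ Sg)) + orbitSub Sg (Sg \ (Sf ∩ Sg))),
      wt F = 2 ^ (m + 1 - r) - 2 ^ (m + 1 - r - μ)) ∧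
    (orbitSub (Sf ∩ Sg) (Sf ∩ Sg) *
        (orbitSub Sf (Sf \ (Sf ∩ Sg)) + orbitSub Sg (Sg \ (Sf ∩ Sg)))).ncard =
      (orbitSub (Sf ∩ Sg) (Sf ∩ Sg)).ncard *
        (orbitSub Sf (Sf \ (Sf ∩ Sg))).ncard *
        (orbitSub Sg (Sg \ (Sf ∩ Sg))).ncard := by
  have hHP : Disjoint (Sf ∩ Sg) (Sf \ (Sf ∩ Sg)) := Finset.disjoint_sdiff
  have hHQ : Disjoint (Sf ∩ Sg) (Sg \ (Sf ∩ Sg)) := Finset.disjoint_sdiff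
  have hPQ : Disjoint (Sf \ (Sf ∩ Sg)) (Sg \ (Sf ∩ Sg)) := by
    rw [Finset.disjoint_left]
    intro i hi hj
    simp only [Finset.mem_sdiff, Finset.mem_inter] at hi hj
    tauto
  have hPc : (Sf \ (Sf ∩ Sg)).card = μ := by
    have := Finset.card_sdiff_add_card_eq_card (Finset.inter_subset_left : Sf ∩ Sg ⊆ Sf)
    omega
  have hQc : (Sg \ (Sf ∩ Sg)).card = μ := by
    have := Finset.card_sdiff_add_card_eq_card (Finset.inter_subset_right : Sf ∩ Sg ⊆ Sg)
    omega
  refine ⟨?_, ncard_orbit_mul_add Finset.inter_subset_left Finset.inter_subset_right hHP hHQ hPQ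
    (by omega) (by omega) (by omega)⟩
  rintro _ ⟨h, hh, _, ⟨f, hf, g, hg, rfl⟩, rfl⟩
  have hw := wt_mul_add hHP hHQ hPQ (hPc.trans hQc.symm) hh hf hg
  rw [← pow_succ', ← pow_succ',
    show m - ((Sf ∩ Sg).card + (Sf \ (Sf ∩ Sg)).card) + 1 = m + 1 - r by omega,
    show m - ((Sf ∩ Sg).card + (Sf \ (Sf ∩ Sg)).card + (Sg \ (Sf ∩ Sg)).card) + 1 =
      m + 1 - r - μ by omega] at hw
  exact Nat.eq_sub_of_add_eq hw
end
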